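/- arXiv:1612.01342 — 2 statements merged into one kernel-verified Lean document; each statement's English description precedes it below -/
import Mathlib

section
/- If in addition p^t > 0 for all t ∈ H, then the charging game admits exactly one Nash equilibrium: the set N is a singleton, equal to the unique minimizer over X of the strictly convex objective F^m(x) + F^m_a(x). -/
/-- Agent `i`'s pay-off: `f(xⁱ, x⁻ⁱ) = Σ_t xⁱᵗ pᵗ (Σ_j xʲᵗ + x⁰ᵗ)`. -/
noncomputable def payoff (h m : ℕ) (p x0 : Fin h → ℝ)
    (x : Fin m → Fin h → ℝ) (i : Fin m) : ℝ :=
  ∑ t, x i t * p t * ((∑ j, x j t) + x0 t)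

/-- Social cost `F^m(x) = Σ_t pᵗ (Σ_i xⁱᵗ + x⁰ᵗ)²`. -/
noncomputable def Fsoc (h m : ℕ) (p x0 : Fin h → ℝ) (x : Fin m → Fin h → ℝ) : ℝ :=
  ∑ t, p t * ((∑ i, x i t) + x0 t) ^ 2

/-- Auxiliary cost `F^m_a(x) = Σ_i Σ_t pᵗ (xⁱᵗ)²`. -/
noncomputable def Faux (h m : ℕ) (p : Fin h → ℝ) (x : Fin m → Fin h → ℝ) : ℝ :=
  ∑ i, ∑ t, p t * (x i t) ^ 2

/-- Constraint set `Xⁱ = {y ∈ ℝ^h : Σ_t yᵗ = γ, yᵗ ∈ [loᵗ, hiᵗ] ∀t}`. -/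
def Xset (h : ℕ) (γ : ℝ) (lo hi : Fin h → ℝ) : Set (Fin h → ℝ) :=
  {y | (∑ t, y t) = γ ∧ ∀ t, y t ∈ Set.Icc (lo t) (hi t)}

theorem sum_update_apply {h m : ℕ} (x : Fin m → Fin h → ℝ) (i : Fin m) (ζ : Fin h → ℝ)
    (t : Fin h) :
    ∑ j, Function.update x i ζ j t = ∑ j, x j t + (ζ t - x i t) := by
  have key : ∀ j, Function.update x i ζ j t = x j t + if j = i then ζ t - x i t else 0 := by
    intro j
    by_cases hj : j = i
    · subst hj; simp
    · simp [hj]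
  simp [key, Finset.sum_add_distrib]

/-- The change in an agent's pay-off under a unilateral deviation. -/
theorem payoff_update {h m : ℕ} (p x0 : Fin h → ℝ) (x : Fin m → Fin h → ℝ) (i : Fin m)
    (ζ : Fin h → ℝ) :
    payoff h m p x0 (Function.update x i ζ) i = payoff h m p x0 x i +
      ∑ t, p t * ((∑ j, x j t) + x0 t + x i t) * (ζ t - x i t) +
      ∑ t, p t * (ζ t - x i t) ^ 2 := by
  unfold payoff
  simp only [sum_update_apply, Function.update_self, ← Finset.sum_add_distrib]
  exact Finset.sum_congr rfl fun t _ => by ring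

/-- The exact second-order expansion of the potential `F^m + F^m_a`. -/
theorem potential_expansion {h m : ℕ} (p x0 : Fin h → ℝ) (x y : Fin m → Fin h → ℝ) :
    Fsoc h m p x0 y + Faux h m p y = Fsoc h m p x0 x + Faux h m p x +
      2 * ∑ i, ∑ t, p t * ((∑ j, x j t) + x0 t + x i t) * (y i t - x i t) +
      ∑ t, p t * (∑ i, (y i t - x i t)) ^ 2 + ∑ i, ∑ t, p t * (y i t - x i t) ^ 2 := by
  have hsoc : Fsoc h m p x0 y = Fsoc h m p x0 x +
      2 * ∑ i, ∑ t, p t * ((∑ j, x j t) + x0 t) * (y i t - x i t) +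
      ∑ t, p t * (∑ i, (y i t - x i t)) ^ 2 := by
    rw [Finset.sum_comm]
    simp only [Fsoc, ← Finset.mul_sum, Finset.sum_sub_distrib]
    rw [Finset.mul_sum, ← Finset.sum_add_distrib, ← Finset.sum_add_distrib]
    exact Finset.sum_congr rfl fun t _ => by ring
  have haux : Faux h m p y = Faux h m p x +
      2 * ∑ i, ∑ t, p t * x i t * (y i t - x i t) +
      ∑ i, ∑ t, p t * (y i t - x i t) ^ 2 := by
    simp only [Faux, Finset.mul_sum, ← Finset.sum_add_distrib]
    exact Finset.sum_congr rfl fun i _ => Finset.sum_congr rfl fun t _ => by ring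
  have hsplit : ∑ i, ∑ t, p t * ((∑ j, x j t) + x0 t + x i t) * (y i t - x i t) =
      ∑ i, ∑ t, p t * ((∑ j, x j t) + x0 t) * (y i t - x i t) +
      ∑ i, ∑ t, p t * x i t * (y i t - x i t) := by
    simp only [← Finset.sum_add_distrib]
    exact Finset.sum_congr rfl fun i _ => Finset.sum_congr rfl fun t _ => by ring
  rw [hsoc, haux, hsplit]
  ring

/-- `F^m + F^m_a` is an exact potential of the game, with factor two. -/
theorem potential_update {h m : ℕ} (p x0 : Fin h → ℝ) (x : Fin m → Fin h → ℝ) (i : Fin m)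
    (ζ : Fin h → ℝ) :
    Fsoc h m p x0 (Function.update x i ζ) + Faux h m p (Function.update x i ζ) =
      Fsoc h m p x0 x + Faux h m p x +
      2 * (payoff h m p x0 (Function.update x i ζ) i - payoff h m p x0 x i) := by
  have hlin : ∑ k, ∑ t, p t * ((∑ j, x j t) + x0 t + x k t) *
        (Function.update x i ζ k t - x k t) =
      ∑ t, p t * ((∑ j, x j t) + x0 t + x i t) * (ζ t - x i t) := by
    rw [Finset.sum_eq_single i (fun k _ hk => by simp [hk]) (by simp)]
    simp
  have hquad : ∑ k, ∑ t, p t * (Function.update x i ζ k t - x k t) ^ 2 =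
      ∑ t, p t * (ζ t - x i t) ^ 2 := by
    rw [Finset.sum_eq_single i (fun k _ hk => by simp [hk]) (by simp)]
    simp
  have hagg : ∀ t, ∑ k, (Function.update x i ζ k t - x k t) = ζ t - x i t := fun t => by
    rw [Finset.sum_sub_distrib, sum_update_apply]; ring
  rw [potential_expansion p x0 x, payoff_update, hlin, hquad]
  simp only [hagg]
  ring

theorem convex_Xset (h : ℕ) (γ : ℝ) (lo hi : Fin h → ℝ) : Convex ℝ (Xset h γ lo hi) := by
  rintro y ⟨hys, hyb⟩ z ⟨hzs, hzb⟩ a b ha hb hab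
  refine ⟨?_, fun t => convex_Icc (lo t) (hi t) (hyb t) (hzb t) ha hb hab⟩
  simp only [Pi.add_apply, Pi.smul_apply, smul_eq_mul, Finset.sum_add_distrib,
    ← Finset.mul_sum, hys, hzs]
  rw [← add_mul, hab, one_mul]

theorem isCompact_Xset (h : ℕ) (γ : ℝ) (lo hi : Fin h → ℝ) : IsCompact (Xset h γ lo hi) := by
  have hbox : IsCompact (Set.univ.pi fun t => Set.Icc (lo t) (hi t)) :=
    isCompact_univ_pi fun t => isCompact_Icc
  refine hbox.of_isClosed_subset ?_ fun y hy t _ => hy.2 t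
  have hset : Xset h γ lo hi =
      {y | ∑ t, y t = γ} ∩ Set.univ.pi fun t => Set.Icc (lo t) (hi t) := by
    ext y; simp only [Xset, Set.mem_inter_iff, Set.mem_setOf_eq, Set.mem_univ_pi]
  rw [hset]
  exact (isClosed_eq (by fun_prop) continuous_const).inter hbox.isClosed

theorem nonneg_of_forall_mul_add_sq_mul_nonneg {a b : ℝ}
    (hab : ∀ ε : ℝ, 0 < ε → ε ≤ 1 → 0 ≤ ε * a + ε ^ 2 * b) : 0 ≤ a := by
  by_contra! ha
  have hb : 0 < b := by nlinarith [hab 1 one_pos le_rfl]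
  have hle : -a ≤ b := by linarith [hab 1 one_pos le_rfl]
  have hε : 0 < -a / (2 * b) := by apply div_pos <;> linarith
  have hε1 : -a / (2 * b) ≤ 1 := by rw [div_le_one (by linarith)]; linarith
  have hbε : -a / (2 * b) * b = -a / 2 := by field_simp
  nlinarith [hab _ hε hε1]

/-- First-order optimality of an agent's best response. -/
theorem marginal_nonneg_of_best_response {h m : ℕ} {p x0 : Fin h → ℝ} {x : Fin m → Fin h → ℝ}
    {i : Fin m} {s : Set (Fin h → ℝ)} (hs : Convex ℝ s) (hx : x i ∈ s)
    (hbest : ∀ ζ ∈ s, payoff h m p x0 x i ≤ payoff h m p x0 (Function.update x i ζ) i)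
    {ζ : Fin h → ℝ} (hζ : ζ ∈ s) :
    0 ≤ ∑ t, p t * ((∑ j, x j t) + x0 t + x i t) * (ζ t - x i t) := by
  refine nonneg_of_forall_mul_add_sq_mul_nonneg (b := ∑ t, p t * (ζ t - x i t) ^ 2)
    fun ε hε hε1 => ?_
  have hmem := hs.add_smul_sub_mem hx hζ ⟨hε.le, hε1⟩
  have hdev := hbest _ hmem
  rw [payoff_update, add_assoc] at hdev
  simp only [Pi.add_apply, Pi.smul_apply, Pi.sub_apply, smul_eq_mul, add_sub_cancel_left] at hdev
  rw [Finset.mul_sum, Finset.mul_sum]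
  convert nonneg_of_le_add_right hdev using 2
  · exact Finset.sum_congr rfl fun t _ => by ring
  · exact Finset.sum_congr rfl fun t _ => by ring

/-- At a profile satisfying every agent's first-order condition, the potential grows at least
like the weighted squared distance. -/
theorem potential_growth {h m : ℕ} {p x0 : Fin h → ℝ} (hp : ∀ t, 0 < p t)
    {x y : Fin m → Fin h → ℝ}
    (hfoc : ∀ i, 0 ≤ ∑ t, p t * ((∑ j, x j t) + x0 t + x i t) * (y i t - x i t)) :
    Fsoc h m p x0 x + Faux h m p x + ∑ i, ∑ t, p t * (y i t - x i t) ^ 2 ≤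
      Fsoc h m p x0 y + Faux h m p y := by
  rw [potential_expansion p x0 x y]
  have hlin := Finset.sum_nonneg fun i (_ : i ∈ Finset.univ) => hfoc i
  have hagg : 0 ≤ ∑ t, p t * (∑ i, (y i t - x i t)) ^ 2 :=
    Finset.sum_nonneg fun t _ => mul_nonneg (hp t).le (sq_nonneg _)
  linarith

theorem eq_of_weighted_sq_dist_nonpos {h m : ℕ} {p : Fin h → ℝ} (hp : ∀ t, 0 < p t)
    {x y : Fin m → Fin h → ℝ} (hxy : ∑ i, ∑ t, p t * (y i t - x i t) ^ 2 ≤ 0) : y = x := by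
  have hterm : ∀ i t, 0 ≤ p t * (y i t - x i t) ^ 2 := fun i t =>
    mul_nonneg (hp t).le (sq_nonneg _)
  have hrow : ∀ i, 0 ≤ ∑ t, p t * (y i t - x i t) ^ 2 := fun i =>
    Finset.sum_nonneg fun t _ => hterm i t
  have hzero := hxy.antisymm (Finset.sum_nonneg fun i _ => hrow i)
  funext i t
  have hi := (Finset.sum_eq_zero_iff_of_nonneg fun i _ => hrow i).1 hzero i (Finset.mem_univ i)
  have hit := (Finset.sum_eq_zero_iff_of_nonneg fun t _ => hterm i t).1 hi t (Finset.mem_univ t)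
  simpa [(hp t).ne', sub_eq_zero] using hit

/-- If in addition `pᵗ > 0` for all `t`, the charging game admits exactly
one Nash equilibrium: the set `N` of Nash equilibria is a singleton `{x⋆}`, where `x⋆`
is the unique minimizer over `X` of the strictly convex objective `F^m + F^m_a`. -/
theorem stmt_7 (h m : ℕ) (hh : 0 < h) (hm : 0 < m)
    (p x0 : Fin h → ℝ) (hp : ∀ t, 0 < p t) (hx0 : ∀ t, 0 ≤ x0 t)
    (γ : Fin m → ℝ) (lo hi : Fin m → Fin h → ℝ)
    (hγ : ∀ i, 0 < γ i) (hlo : ∀ i t, 0 ≤ lo i t) (hlohi : ∀ i t, lo i t ≤ hi i t)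
    (hXne : ∀ i, (Xset h (γ i) (lo i) (hi i)).Nonempty) :
    ∃ xs : Fin m → Fin h → ℝ,
      -- N is the singleton {xs}
      {x : Fin m → Fin h → ℝ | (∀ i, x i ∈ Xset h (γ i) (lo i) (hi i)) ∧
          ∀ i, ∀ ζ ∈ Xset h (γ i) (lo i) (hi i),
            payoff h m p x0 x i ≤ payoff h m p x0 (Function.update x i ζ) i} = {xs} ∧
      -- xs is a minimizer of F^m + F^m_a over X
      (∀ i, xs i ∈ Xset h (γ i) (lo i) (hi i)) ∧
      (∀ y : Fin m → Fin h → ℝ, (∀ i, y i ∈ Xset h (γ i) (lo i) (hi i)) →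
        Fsoc h m p x0 xs + Faux h m p xs ≤ Fsoc h m p x0 y + Faux h m p y) ∧
      -- and it is the unique such minimizer
      (∀ y : Fin m → Fin h → ℝ, (∀ i, y i ∈ Xset h (γ i) (lo i) (hi i)) →
        (∀ z : Fin m → Fin h → ℝ, (∀ i, z i ∈ Xset h (γ i) (lo i) (hi i)) →
          Fsoc h m p x0 y + Faux h m p y ≤ Fsoc h m p x0 z + Faux h m p z) → y = xs) := by
  have hcompact : IsCompact (Set.univ.pi fun i => Xset h (γ i) (lo i) (hi i)) :=
    isCompact_univ_pi fun i => isCompact_Xset h (γ i) (lo i) (hi i)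
  have hcont : Continuous fun x : Fin m → Fin h → ℝ => Fsoc h m p x0 x + Faux h m p x := by
    unfold Fsoc Faux
    fun_prop
  obtain ⟨xs, hxs, hmin⟩ := hcompact.exists_isMinOn
    (Set.univ_pi_nonempty_iff.2 hXne) hcont.continuousOn
  have hmem : ∀ i, xs i ∈ Xset h (γ i) (lo i) (hi i) := fun i => hxs i (Set.mem_univ i)
  have hle : ∀ y : Fin m → Fin h → ℝ, (∀ i, y i ∈ Xset h (γ i) (lo i) (hi i)) →
      Fsoc h m p x0 xs + Faux h m p xs ≤ Fsoc h m p x0 y + Faux h m p y :=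
    fun y hy => hmin fun i _ => hy i
  have hbest : ∀ x : Fin m → Fin h → ℝ, (∀ i, x i ∈ Xset h (γ i) (lo i) (hi i)) →
      (∀ y : Fin m → Fin h → ℝ, (∀ i, y i ∈ Xset h (γ i) (lo i) (hi i)) →
        Fsoc h m p x0 x + Faux h m p x ≤ Fsoc h m p x0 y + Faux h m p y) →
      ∀ i, ∀ ζ ∈ Xset h (γ i) (lo i) (hi i),
        payoff h m p x0 x i ≤ payoff h m p x0 (Function.update x i ζ) i := by
    intro x hx hxmin i ζ hζ
    have hdev := hxmin (Function.update x i ζ) fun k => by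
      by_cases hk : k = i
      · subst hk; simpa using hζ
      · simpa [hk] using hx k
    rw [potential_update] at hdev
    linarith
  have huniq : ∀ x : Fin m → Fin h → ℝ, (∀ i, x i ∈ Xset h (γ i) (lo i) (hi i)) →
      (∀ i, ∀ ζ ∈ Xset h (γ i) (lo i) (hi i),
        payoff h m p x0 x i ≤ payoff h m p x0 (Function.update x i ζ) i) → x = xs := by
    intro x hx hnash
    have hgrow := potential_growth hp (y := xs) fun i =>
      marginal_nonneg_of_best_response (convex_Xset h _ _ _) (hx i) (hnash i) (hmem i)
    exact (eq_of_weighted_sq_dist_nonpos hp (by linarith [hle x hx])).symm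
  refine ⟨xs, ?_, hmem, hle, fun y hy hymin => huniq y hy (hbest y hy hymin)⟩
  ext x
  constructor
  · exact fun hx => huniq x hx.1 hx.2
  · rintro rfl
    exact ⟨hmem, hbest x hmem hle⟩
end

section
/- Suppose p^t > 0 for all t ∈ H and there exist deterministic bounds 0 < γ̲ ≤ γ̄ < ∞ with γ^i ∈ [γ̲, γ̄] for all i ∈ I. If x⋆ ∈ X is a minimizer of F^m over X and x_a⋆ ∈ X is a minimizer of F^m + F^m_a over X, then 0 ≤ (F^m(x_a⋆) − F^m(x⋆)) / F^m(x⋆) ≤ (p̄ · h · γ̄²) / (p̲ · m · γ̲²), where p̄ = max_{t∈H} p^t and p̲ = min_{t∈H} p^t. In particular, the relative optimality gap between the unique Nash equilibrium and the social optimum tends to 0 as m → ∞. -/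
/-- For nonnegative `y` and weights at most `P`, the weighted sum of squares is at most
`P` times the square of the sum. -/
lemma weighted_sum_sq_le_mul_sum_sq {h : ℕ} {p y : Fin h → ℝ} {P : ℝ} (hP : 0 ≤ P)
    (hp : ∀ t, p t ≤ P) (hy : ∀ t, 0 ≤ y t) :
    ∑ t, p t * y t ^ 2 ≤ P * (∑ t, y t) ^ 2 := by
  calc ∑ t, p t * y t ^ 2 ≤ ∑ t, P * y t ^ 2 := by
        gcongr with t
        exact hp t
    _ = P * ∑ t, y t ^ 2 := by rw [Finset.mul_sum]
    _ ≤ P * (∑ t, y t) ^ 2 := by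
        gcongr
        exact Finset.sum_sq_le_sq_sum_of_nonneg fun t _ => hy t

lemma Faux_le {h m : ℕ} {p : Fin h → ℝ} {x : Fin m → Fin h → ℝ} {P c : ℝ} (hP : 0 ≤ P)
    (hp : ∀ t, p t ≤ P) (hx : ∀ i t, 0 ≤ x i t) (hc : ∀ i, ∑ t, x i t ≤ c) :
    Faux h m p x ≤ P * (m * c ^ 2) := by
  calc Faux h m p x ≤ ∑ _i : Fin m, P * c ^ 2 := by
        unfold Faux
        refine Finset.sum_le_sum fun i _ =>
          (weighted_sum_sq_le_mul_sum_sq hP hp (hx i)).trans ?_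
        have := Finset.sum_nonneg fun t (_ : t ∈ Finset.univ) => hx i t
        gcongr
        exact hc i
    _ = P * (m * c ^ 2) := by
        simp only [Finset.sum_const, Finset.card_univ, Fintype.card_fin, nsmul_eq_mul]
        ring

lemma Faux_nonneg {h m : ℕ} {p : Fin h → ℝ} (hp : ∀ t, 0 ≤ p t) (x : Fin m → Fin h → ℝ) :
    0 ≤ Faux h m p x :=
  Finset.sum_nonneg fun _ _ => Finset.sum_nonneg fun t _ => mul_nonneg (hp t) (sq_nonneg _)

/-- Cauchy–Schwarz lower bound for the social cost. -/
lemma le_mul_Fsoc {h m : ℕ} {p x0 : Fin h → ℝ} {x : Fin m → Fin h → ℝ} {q c : ℝ} (hq : 0 ≤ q)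
    (hp : ∀ t, q ≤ p t) (hx0 : ∀ t, 0 ≤ x0 t) (hc0 : 0 ≤ c) (hc : ∀ i, c ≤ ∑ t, x i t) :
    q * (m * c) ^ 2 ≤ h * Fsoc h m p x0 x := by
  have hsum : (m : ℝ) * c ≤ ∑ t, ((∑ i, x i t) + x0 t) := by
    rw [Finset.sum_add_distrib, Finset.sum_comm]
    have h1 : ∑ _i : Fin m, c ≤ ∑ i, ∑ t, x i t := Finset.sum_le_sum fun i _ => hc i
    have h2 : 0 ≤ ∑ t, x0 t := Finset.sum_nonneg fun t _ => hx0 t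
    simp only [Finset.sum_const, Finset.card_univ, Fintype.card_fin, nsmul_eq_mul] at h1
    linarith
  have hcs := sq_sum_le_card_mul_sum_sq (s := Finset.univ)
    (f := fun t : Fin h => (∑ i, x i t) + x0 t)
  rw [Finset.card_univ, Fintype.card_fin] at hcs
  calc q * (m * c) ^ 2 ≤ q * (∑ t, ((∑ i, x i t) + x0 t)) ^ 2 := by gcongr
    _ ≤ q * (h * ∑ t, ((∑ i, x i t) + x0 t) ^ 2) := by gcongr
    _ = h * ∑ t, q * ((∑ i, x i t) + x0 t) ^ 2 := by
        rw [← Finset.mul_sum]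
        ring
    _ ≤ h * Fsoc h m p x0 x := by
        unfold Fsoc
        gcongr with t
        exact hp t

/-- Suppose `pᵗ > 0` for all `t` and `γⁱ ∈ [γ̲, γ̄]` for all `i`, with
deterministic bounds `0 < γ̲ ≤ γ̄ < ∞`. If `x⋆` minimizes `F^m` over `X` and `x_a⋆`
minimizes `F^m + F^m_a` over `X` (i.e. `x_a⋆` is the Nash equilibrium), then
`0 ≤ (F^m(x_a⋆) - F^m(x⋆)) / F^m(x⋆) ≤ (p̄ h γ̄²) / (p̲ m γ̲²)`,
where `p̄ = max_t pᵗ`, `p̲ = min_t pᵗ`; in particular the relative optimality gap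
tends to `0` as `m → ∞`. -/
theorem stmt_11 (h m : ℕ) (hh : 0 < h) (hm : 0 < m)
    (p x0 : Fin h → ℝ) (hp : ∀ t, 0 < p t) (hx0 : ∀ t, 0 ≤ x0 t)
    (γlb γub : ℝ) (hγlb : 0 < γlb) (hγlbub : γlb ≤ γub)
    (γ : Fin m → ℝ) (lo hi : Fin m → Fin h → ℝ)
    (hγ : ∀ i, 0 < γ i) (hγbds : ∀ i, γ i ∈ Set.Icc γlb γub)
    (hlo : ∀ i t, 0 ≤ lo i t) (hlohi : ∀ i t, lo i t ≤ hi i t)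
    (hXne : ∀ i, (Xset h (γ i) (lo i) (hi i)).Nonempty)
    (xs xas : Fin m → Fin h → ℝ)
    (hxs : ∀ i, xs i ∈ Xset h (γ i) (lo i) (hi i))
    (hxsmin : ∀ y : Fin m → Fin h → ℝ, (∀ i, y i ∈ Xset h (γ i) (lo i) (hi i)) →
      Fsoc h m p x0 xs ≤ Fsoc h m p x0 y)
    (hxas : ∀ i, xas i ∈ Xset h (γ i) (lo i) (hi i))
    (hxasmin : ∀ y : Fin m → Fin h → ℝ, (∀ i, y i ∈ Xset h (γ i) (lo i) (hi i)) →
      Fsoc h m p x0 xas + Faux h m p xas ≤ Fsoc h m p x0 y + Faux h m p y) :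
    0 ≤ (Fsoc h m p x0 xas - Fsoc h m p x0 xs) / Fsoc h m p x0 xs ∧
      (Fsoc h m p x0 xas - Fsoc h m p x0 xs) / Fsoc h m p x0 xs ≤
        Finset.univ.sup' (Finset.univ_nonempty_iff.mpr (Fin.pos_iff_nonempty.mp hh)) p *
            h * γub ^ 2 /
          (Finset.univ.inf' (Finset.univ_nonempty_iff.mpr (Fin.pos_iff_nonempty.mp hh)) p *
            m * γlb ^ 2) := by
  have hne : (Finset.univ : Finset (Fin h)).Nonempty :=
    Finset.univ_nonempty_iff.mpr (Fin.pos_iff_nonempty.mp hh)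
  set P := Finset.univ.sup' (Finset.univ_nonempty_iff.mpr (Fin.pos_iff_nonempty.mp hh)) p
  set q := Finset.univ.inf' (Finset.univ_nonempty_iff.mpr (Fin.pos_iff_nonempty.mp hh)) p
  have hpP : ∀ t, p t ≤ P := fun t => Finset.le_sup' p (Finset.mem_univ t)
  have hqp : ∀ t, q ≤ p t := fun t => Finset.inf'_le p (Finset.mem_univ t)
  have hq : 0 < q := (Finset.lt_inf'_iff hne).mpr fun t _ => hp t
  have hP : 0 < P := (hp ⟨0, hh⟩).trans_le (hpP _)
  have hhR : (0 : ℝ) < h := Nat.cast_pos.mpr hh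
  have hmR : (0 : ℝ) < m := Nat.cast_pos.mpr hm
  have hlow : q * (m * γlb) ^ 2 ≤ h * Fsoc h m p x0 xs :=
    le_mul_Fsoc hq.le hqp hx0 hγlb.le fun i => (hγbds i).1.trans_eq (hxs i).1.symm
  have hup : Faux h m p xs ≤ P * (m * γub ^ 2) :=
    Faux_le hP.le hpP (fun i t => (hlo i t).trans ((hxs i).2 t).1)
      fun i => (hxs i).1.trans_le (hγbds i).2
  have hF : 0 < Fsoc h m p x0 xs :=
    pos_of_mul_pos_right (lt_of_lt_of_le (by positivity) hlow) hhR.le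
  have hgap : Fsoc h m p x0 xas - Fsoc h m p x0 xs ≤ P * (m * γub ^ 2) := by
    linarith [hxasmin xs hxs, Faux_nonneg (fun t => (hp t).le) xas]
  refine ⟨div_nonneg (sub_nonneg.mpr (hxsmin xas hxas)) hF.le, ?_⟩
  rw [div_le_div_iff₀ hF (by positivity)]
  calc (Fsoc h m p x0 xas - Fsoc h m p x0 xs) * (q * m * γlb ^ 2)
      ≤ P * (m * γub ^ 2) * (q * m * γlb ^ 2) := by gcongr
    _ = P * γub ^ 2 * (q * (m * γlb) ^ 2) := by ring
    _ ≤ P * γub ^ 2 * (h * Fsoc h m p x0 xs) := by gcongr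
    _ = P * h * γub ^ 2 * Fsoc h m p x0 xs := by ring
end
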